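/- Among fields of the form Q(√m₁, ..., √m_k) with m_j distinct squarefree integers greater than 1, the only ones equal to some Q(cos(2π/n)) with n ≥ 3 are Q(√5), Q(√2), Q(√3), and Q(√2, √3), realized by n = 5, 8, 12, 24 respectively (up to the identifications Q_5 = Q_{10}). -/

import Mathlib

open IntermediateField

lemma comb (n : ℕ) (hn : 3 ≤ n)
    (h : ∀ a : ℕ, a.Coprime n → (n:ℤ) ∣ (a:ℤ)^2 - 1 ∨ (n:ℤ) ∣ (a:ℤ)^2 + 1) :
    n = 3 ∨ n = 4 ∨ n = 6 ∨ n = 5 ∨ n = 10 ∨ n = 8 ∨ n = 12 ∨ n = 24 := by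
  have small : ∀ k : ℕ, 0 < k → k ≤ 26 → (n:ℤ) ∣ (k:ℤ) → n ≤ 26 := by
    intro k hk hk2 hd
    have := Nat.le_of_dvd hk (by exact_mod_cast hd)
    omega
  by_cases h30 : 30 ∣ n
  · exfalso
    obtain ⟨k, m, hm, hkm⟩ := Nat.exists_eq_pow_mul_and_not_dvd (n := n) (by omega) 5 (by norm_num)
    have h5p : Nat.Prime 5 := by norm_num
    have hc : Nat.Coprime m (5^k) := ((h5p.coprime_iff_not_dvd.2 hm).pow_left k).symm
    have hk : 0 < k := by
      rcases Nat.eq_zero_or_pos k with rfl | hk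
      · simp at hkm; subst hkm; exact (hm (by omega)).elim
      · exact hk
    have h3m : 3 ∣ m := by
      have : 3 ∣ 5^k * m := hkm ▸ (by omega)
      exact (Nat.Coprime.pow_right k (by norm_num : Nat.Coprime 3 5)).dvd_of_dvd_mul_left this
    obtain ⟨a, ha1, ha2⟩ := Nat.chineseRemainder hc 1 2
    have ha5 : a ≡ 2 [MOD 5] := ha2.of_dvd (dvd_pow_self 5 hk.ne')
    have ha3 : a ≡ 1 [MOD 3] := ha1.of_dvd h3m
    have hcop : a.Coprime n := by
      rw [hkm]
      refine Nat.Coprime.mul_right (Nat.Coprime.pow_right k ?_) ?_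
      · rw [Nat.coprime_comm, h5p.coprime_iff_not_dvd]
        unfold Nat.ModEq at ha5; omega
      · have := ha1.gcd_eq
        simpa [Nat.Coprime] using this
    have e5 : (a:ℤ) % 5 = 2 := by unfold Nat.ModEq at ha5; omega
    have e3 : (a:ℤ) % 3 = 1 := by unfold Nat.ModEq at ha3; omega
    rcases h a hcop with h1 | h1
    · have h2 : (5:ℤ) ∣ (a:ℤ)^2 - 1 := dvd_trans (by omega) h1
      have := Int.emod_emod_of_dvd
      have : ((a:ℤ)^2 - 1) % 5 = 3 := by simp [Int.sub_emod, pow_two, Int.mul_emod, e5]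
      omega
    · have h2 : (3:ℤ) ∣ (a:ℤ)^2 + 1 := dvd_trans (by omega) h1
      have : ((a:ℤ)^2 + 1) % 3 = 2 := by simp [Int.add_emod, pow_two, Int.mul_emod, e3]
      omega
  have hle : n ≤ 26 := by
    by_cases h2 : 2 ∣ n
    · by_cases h3 : 3 ∣ n
      · have h5 : ¬ 5 ∣ n := by omega
        rcases h 5 ((Nat.Prime.coprime_iff_not_dvd (by norm_num)).2 h5) with h | h
        · exact small 24 (by norm_num) (by norm_num) (by simpa using h)
        · exact small 26 (by norm_num) (by norm_num) (by simpa using h)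
      · rcases h 3 ((Nat.Prime.coprime_iff_not_dvd (by norm_num)).2 h3) with h | h
        · exact small 8 (by norm_num) (by norm_num) (by simpa using h)
        · exact small 10 (by norm_num) (by norm_num) (by simpa using h)
    · rcases h 2 ((Nat.Prime.coprime_iff_not_dvd (by norm_num)).2 h2) with h | h
      · exact small 3 (by norm_num) (by norm_num) (by simpa using h)
      · exact small 5 (by norm_num) (by norm_num) (by simpa using h)
  have q2 := h 2
  have q3 := h 3
  have q5 := h 5
  have q7 := h 7
  clear h small h30
  interval_cases n <;> first | omega | (exfalso; revert q2 q3 q5 q7; norm_num)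

lemma key (s : Finset ℕ) (n : ℕ) (hn : 3 ≤ n)
    (h : IntermediateField.adjoin ℚ ((fun m : ℕ => Real.sqrt m) '' ↑s) =
          ℚ⟮Real.cos ((2 : ℝ) * Real.pi / n)⟯) (a : ℕ) (ha : a.Coprime n) :
    (n:ℤ) ∣ (a:ℤ)^2 - 1 ∨ (n:ℤ) ∣ (a:ℤ)^2 + 1 := by
  have hn0 : n ≠ 0 := by omega
  have : NeZero n := ⟨hn0⟩
  set ζ : ℂ := Complex.exp (2 * Real.pi * Complex.I / n) with hζdef
  have hζ : IsPrimitiveRoot ζ n := Complex.isPrimitiveRoot_exp n hn0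
  have hζ0 : ζ ≠ 0 := Complex.exp_ne_zero _
  have hcos : ((Real.cos (2 * Real.pi / n) : ℝ) : ℂ) = (ζ + ζ⁻¹) / 2 := by
    rw [Complex.ofReal_cos, Complex.cos, hζdef, ← Complex.exp_neg]
    push_cast
    congr 3 <;> ring_nf
  have hint : IsIntegral ℚ ζ := (hζ.isIntegral (by omega)).tower_top
  let g : ℚ⟮ζ⟯ := IntermediateField.AdjoinSimple.gen ℚ ζ
  have hg : (g : ℂ) = ζ := IntermediateField.AdjoinSimple.coe_gen ℚ ζ
  obtain ⟨σ, hσ⟩ : ∃ σ : ℚ⟮ζ⟯ →ₐ[ℚ] ℚ⟮ζ⟯, σ g = g ^ a := by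
    have hmin : minpoly ℚ g = minpoly ℚ (g^a) := by
      have hgp : IsPrimitiveRoot g n := by
        rw [← hg] at hζ
        exact IsPrimitiveRoot.coe_submonoidClass_iff.1 hζ
      rw [← Polynomial.cyclotomic_eq_minpoly_rat hgp (by omega),
        ← Polynomial.cyclotomic_eq_minpoly_rat (hgp.pow_of_coprime a ha) (by omega)]
    refine ⟨(IntermediateField.adjoin.powerBasis hint).lift (g^a) ?_, ?_⟩
    · rw [IntermediateField.adjoin.powerBasis_gen]
      change Polynomial.aeval _ (minpoly ℚ g) = 0
      rw [hmin]; exact minpoly.aeval _ _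
    · have e : g = (IntermediateField.adjoin.powerBasis hint).gen :=
        (IntermediateField.adjoin.powerBasis_gen hint).symm
      conv_lhs => arg 2; rw [e]
      exact (IntermediateField.adjoin.powerBasis hint).lift_gen _ _
  have hmem : ∀ y ∈ ℚ⟮Real.cos ((2 : ℝ) * Real.pi / n)⟯, ∃ z : ℚ⟮ζ⟯, (z:ℂ) = (y:ℝ) := by
    intro y hy
    induction hy using IntermediateField.adjoin_induction with
    | mem x hx =>
      rw [Set.mem_singleton_iff] at hx
      subst hx
      exact ⟨(g + g⁻¹)/2, by rw [hcos]; push_cast; rw [hg]; rfl⟩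
    | algebraMap x => exact ⟨algebraMap _ _ x, by simp⟩
    | add x y _ _ hx hy =>
      obtain ⟨z, hz⟩ := hx; obtain ⟨w, hw⟩ := hy; exact ⟨z + w, by push_cast; rw [hz, hw]⟩
    | mul x y _ _ hx hy =>
      obtain ⟨z, hz⟩ := hx; obtain ⟨w, hw⟩ := hy; exact ⟨z * w, by push_cast; rw [hz, hw]⟩
    | inv x _ hx =>
      obtain ⟨z, hz⟩ := hx; exact ⟨z⁻¹, by push_cast; rw [hz]⟩
  have hfix : ∀ y ∈ IntermediateField.adjoin ℚ ((fun m : ℕ => Real.sqrt m) '' (↑s : Set ℕ)),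
      ∃ z : ℚ⟮ζ⟯, (z:ℂ) = (y:ℝ) ∧ σ (σ z) = z := by
    intro y hy
    induction hy using IntermediateField.adjoin_induction with
    | mem x hx =>
      have hx' := IntermediateField.subset_adjoin ℚ _ hx
      obtain ⟨m, hm, rfl⟩ := hx
      rw [h] at hx'
      obtain ⟨z, hz⟩ := hmem _ hx'
      refine ⟨z, hz, ?_⟩
      have h2 : z ^ 2 = (m : ℚ⟮ζ⟯) := by
        apply Subtype.ext
        push_cast
        rw [hz, ← Complex.ofReal_pow, Real.sq_sqrt (Nat.cast_nonneg m)]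
        simp
      have h3 : (σ z) ^ 2 = z ^ 2 := by
        rw [← map_pow, h2, map_natCast]
      rcases sq_eq_sq_iff_eq_or_eq_neg.1 h3 with h4 | h4
      · rw [h4, h4]
      · rw [h4, map_neg, h4, neg_neg]
    | algebraMap x => exact ⟨algebraMap _ _ x, by simp, by simp⟩
    | add x y _ _ hx hy =>
      obtain ⟨z, hz, h1⟩ := hx; obtain ⟨w, hw, h2⟩ := hy
      exact ⟨z + w, by push_cast; rw [hz, hw], by simp [h1, h2]⟩
    | mul x y _ _ hx hy =>
      obtain ⟨z, hz, h1⟩ := hx; obtain ⟨w, hw, h2⟩ := hy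
      exact ⟨z * w, by push_cast; rw [hz, hw], by simp [h1, h2]⟩
    | inv x _ hx =>
      obtain ⟨z, hz, h1⟩ := hx; exact ⟨z⁻¹, by push_cast; rw [hz], by simp [h1]⟩
  obtain ⟨z, hz, hzz⟩ := hfix (Real.cos ((2 : ℝ) * Real.pi / n))
    (by rw [h]; exact IntermediateField.mem_adjoin_simple_self _ _)
  have hz' : z = (g + g⁻¹)/2 := by
    apply Subtype.ext; rw [hz, hcos]; push_cast; rw [hg]; rfl
  have h2 : g^(a^2) + (g^(a^2))⁻¹ = g + g⁻¹ := by
    have : (g^(a^2) + (g^(a^2))⁻¹)/2 = (g + g⁻¹)/2 := by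
      rw [hz'] at hzz
      have t2 : σ 2 = 2 := map_ofNat σ 2
      rwa [map_div₀, map_div₀, t2, t2, map_add, map_add, map_inv₀, map_inv₀, hσ, map_pow, hσ,
        ← pow_mul, ← pow_two] at hzz
    linear_combination 2 * this
  have h3 : ζ^(a^2) + (ζ^(a^2))⁻¹ = ζ + ζ⁻¹ := by
    have := congrArg (fun t : ℚ⟮ζ⟯ => (t:ℂ)) h2
    push_cast at this
    rwa [hg] at this
  have h4 : (ζ^(a^2) - ζ) * (ζ^(a^2) * ζ - 1) = 0 := by
    have : ζ^(a^2) ≠ 0 := pow_ne_zero _ hζ0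
    field_simp at h3
    linear_combination h3
  rcases mul_eq_zero.1 h4 with h5 | h5
  · left
    rw [← hζ.zpow_eq_one_iff_dvd, zpow_sub₀ hζ0, zpow_one]
    rw [div_eq_one_iff_eq hζ0]
    exact_mod_cast sub_eq_zero.1 h5
  · right
    rw [← hζ.zpow_eq_one_iff_dvd, zpow_add₀ hζ0, zpow_one]
    exact_mod_cast sub_eq_zero.1 h5

lemma simple_eq {x y : ℝ} (h1 : x ∈ ℚ⟮y⟯) (h2 : y ∈ ℚ⟮x⟯) : ℚ⟮x⟯ = ℚ⟮y⟯ :=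
  le_antisymm (adjoin_simple_le_iff.2 h1) (adjoin_simple_le_iff.2 h2)

lemma simple_eq' {x y : ℝ} (a b : ℚ) (hb : b ≠ 0) (h1 : x = a + b * y) : ℚ⟮x⟯ = ℚ⟮y⟯ := by
  have hq : ∀ (K : IntermediateField ℚ ℝ) (q : ℚ), (q:ℝ) ∈ K := fun K q => K.algebraMap_mem q
  apply simple_eq
  · rw [h1]
    exact add_mem (hq _ _) (mul_mem (hq _ _) (mem_adjoin_simple_self _ _))
  · have hb' : (b:ℝ) ≠ 0 := by exact_mod_cast hb
    have : y = (x - a) / b := by rw [h1]; field_simp; ring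
    rw [this]
    exact div_mem (sub_mem (mem_adjoin_simple_self _ _) (hq _ _)) (hq _ _)

lemma f5 : ℚ⟮Real.cos ((2 : ℝ) * Real.pi / (5 : ℕ))⟯ = ℚ⟮Real.sqrt 5⟯ := by
  apply simple_eq' (-1/4) (1/4) (by norm_num)
  have : (2 : ℝ) * Real.pi / (5 : ℕ) = 2 * (Real.pi / 5) := by push_cast; ring
  rw [this, Real.cos_two_mul, Real.cos_pi_div_five]
  have := Real.sq_sqrt (show (0:ℝ) ≤ 5 by norm_num)
  push_cast
  linear_combination this / 8

lemma f10 : ℚ⟮Real.cos ((2 : ℝ) * Real.pi / (10 : ℕ))⟯ = ℚ⟮Real.sqrt 5⟯ := by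
  apply simple_eq' (1/4) (1/4) (by norm_num)
  have : (2 : ℝ) * Real.pi / (10 : ℕ) = (Real.pi / 5) := by push_cast; ring
  rw [this, Real.cos_pi_div_five]
  push_cast
  ring

lemma f8 : ℚ⟮Real.cos ((2 : ℝ) * Real.pi / (8 : ℕ))⟯ = ℚ⟮Real.sqrt 2⟯ := by
  apply simple_eq' 0 (1/2) (by norm_num)
  have : (2 : ℝ) * Real.pi / (8 : ℕ) = (Real.pi / 4) := by push_cast; ring
  rw [this, Real.cos_pi_div_four]
  push_cast
  ring

lemma f12 : ℚ⟮Real.cos ((2 : ℝ) * Real.pi / (12 : ℕ))⟯ = ℚ⟮Real.sqrt 3⟯ := by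
  apply simple_eq' 0 (1/2) (by norm_num)
  have : (2 : ℝ) * Real.pi / (12 : ℕ) = (Real.pi / 6) := by push_cast; ring
  rw [this, Real.cos_pi_div_six]
  push_cast
  ring

lemma f24 : ℚ⟮Real.cos ((2 : ℝ) * Real.pi / (24 : ℕ))⟯ =
      IntermediateField.adjoin ℚ {Real.sqrt 2, Real.sqrt 3} := by
  have hx : Real.cos ((2 : ℝ) * Real.pi / (24 : ℕ)) = √2 * (1 + √3) / 4 := by
    have : (2 : ℝ) * Real.pi / (24 : ℕ) = Real.pi / 3 - Real.pi / 4 := by push_cast; ring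
    rw [this, Real.cos_sub]
    simp
    ring
  rw [hx]
  have s2 := Real.sq_sqrt (show (0:ℝ) ≤ 2 by norm_num)
  have s3 := Real.sq_sqrt (show (0:ℝ) ≤ 3 by norm_num)
  apply le_antisymm
  · rw [adjoin_simple_le_iff]
    have h2 : √2 ∈ IntermediateField.adjoin ℚ {√2, √3} := subset_adjoin _ _ (by simp)
    have h3 : √3 ∈ IntermediateField.adjoin ℚ {√2, √3} := subset_adjoin _ _ (by simp)
    exact div_mem (mul_mem h2 (add_mem (one_mem _) h3)) (ofNat_mem _ 4)
  · set y := √2 * (1 + √3) / 4 with hy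
    have hyK : y ∈ ℚ⟮y⟯ := mem_adjoin_simple_self _ _
    have e3 : √3 = 4 * y^2 - 2 := by
      rw [hy]; linear_combination (-(1+√3)^2/4) * s2 - (1/2) * s3
    have h3 : √3 ∈ ℚ⟮y⟯ := by
      rw [e3]; exact sub_mem (mul_mem (ofNat_mem _ 4) (pow_mem hyK 2)) (ofNat_mem _ 2)
    have h2 : √2 ∈ ℚ⟮y⟯ := by
      have : √2 = 4 * y / (1 + √3) := by
        have : (1 + √3) ≠ 0 := by positivity
        rw [hy]; field_simp
      rw [this]
      exact div_mem (mul_mem (ofNat_mem _ 4) hyK) (add_mem (one_mem _) h3)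
    rw [adjoin_le_iff]
    rintro x (rfl | rfl)
    · exact h2
    · exact h3

lemma not_rat (s : Finset ℕ) (hne : s.Nonempty)
    (hsq : ∀ m ∈ s, Squarefree m ∧ 1 < m) (x : ℝ) (q : ℚ) (hx : x = q)
    (h : IntermediateField.adjoin ℚ ((fun m : ℕ => Real.sqrt m) '' ↑s) = ℚ⟮x⟯) : False := by
  obtain ⟨m, hm⟩ := hne
  have h1 : √(m:ℝ) ∈ IntermediateField.adjoin ℚ ((fun m : ℕ => Real.sqrt m) '' (↑s : Set ℕ)) :=
    subset_adjoin _ _ ⟨m, hm, rfl⟩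
  have hb : ℚ⟮x⟯ = ⊥ := by
    rw [adjoin_simple_eq_bot_iff, hx]
    exact IntermediateField.algebraMap_mem _ q
  rw [h, hb, mem_bot] at h1
  obtain ⟨hs, hm1⟩ := hsq m hm
  have hirr : Irrational √(m:ℝ) := by
    rw [irrational_sqrt_natCast_iff]
    rintro ⟨r, rfl⟩
    have := Nat.isUnit_iff.1 (hs r dvd_rfl)
    subst this
    omega
  obtain ⟨q', hq'⟩ := h1
  exact hirr ⟨q', by simpa using hq'⟩

/-- Among multiquadratic fields `ℚ(√m₁, …, √m_k)` with the `m_j` distinct squarefree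
integers `> 1`, the only ones equal to some `ℚ(cos(2π/n))` with `n ≥ 3` are
`ℚ(√5)`, `ℚ(√2)`, `ℚ(√3)` and `ℚ(√2, √3)`, realized by `n = 5, 8, 12, 24`. -/
theorem stmt18 (s : Finset ℕ) (hne : s.Nonempty)
    (hsq : ∀ m ∈ s, Squarefree m ∧ 1 < m) :
    ((∃ n : ℕ, 3 ≤ n ∧
        IntermediateField.adjoin ℚ ((fun m : ℕ => Real.sqrt m) '' ↑s) =
          ℚ⟮Real.cos ((2 : ℝ) * Real.pi / n)⟯) →
      (IntermediateField.adjoin ℚ ((fun m : ℕ => Real.sqrt m) '' ↑s) = ℚ⟮Real.sqrt 5⟯ ∨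
       IntermediateField.adjoin ℚ ((fun m : ℕ => Real.sqrt m) '' ↑s) = ℚ⟮Real.sqrt 2⟯ ∨
       IntermediateField.adjoin ℚ ((fun m : ℕ => Real.sqrt m) '' ↑s) = ℚ⟮Real.sqrt 3⟯ ∨
       IntermediateField.adjoin ℚ ((fun m : ℕ => Real.sqrt m) '' ↑s) =
         IntermediateField.adjoin ℚ {Real.sqrt 2, Real.sqrt 3})) ∧
    ℚ⟮Real.cos ((2 : ℝ) * Real.pi / (5 : ℕ))⟯ = ℚ⟮Real.sqrt 5⟯ ∧
    ℚ⟮Real.cos ((2 : ℝ) * Real.pi / (8 : ℕ))⟯ = ℚ⟮Real.sqrt 2⟯ ∧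
    ℚ⟮Real.cos ((2 : ℝ) * Real.pi / (12 : ℕ))⟯ = ℚ⟮Real.sqrt 3⟯ ∧
    ℚ⟮Real.cos ((2 : ℝ) * Real.pi / (24 : ℕ))⟯ =
      IntermediateField.adjoin ℚ {Real.sqrt 2, Real.sqrt 3} := by
  refine ⟨?_, f5, f8, f12, f24⟩
  rintro ⟨n, hn, h⟩
  rcases comb n hn (key s n hn h) with rfl | rfl | rfl | rfl | rfl | rfl | rfl | rfl
  · refine (not_rat s hne hsq _ (-1/2) ?_ h).elim
    have : (2 : ℝ) * Real.pi / (3 : ℕ) = Real.pi - Real.pi / 3 := by push_cast; ring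
    rw [this, Real.cos_pi_sub, Real.cos_pi_div_three]; norm_num
  · refine (not_rat s hne hsq _ 0 ?_ h).elim
    have : (2 : ℝ) * Real.pi / (4 : ℕ) = Real.pi / 2 := by push_cast; ring
    rw [this, Real.cos_pi_div_two]; norm_num
  · refine (not_rat s hne hsq _ (1/2) ?_ h).elim
    have : (2 : ℝ) * Real.pi / (6 : ℕ) = Real.pi / 3 := by push_cast; ring
    rw [this, Real.cos_pi_div_three]; norm_num
  · exact Or.inl (h.trans f5)
  · exact Or.inl (h.trans f10)
  · exact Or.inr (Or.inl (h.trans f8))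
  · exact Or.inr (Or.inr (Or.inl (h.trans f12)))
  · exact Or.inr (Or.inr (Or.inr (h.trans f24)))
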